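/- Let d, n ≥ 1 and let 𝐪 = (Q_1, …, Q_n) be an n-tuple of quadratic forms in d variables. Then for any exponents with 2 ≤ p < q ≤ ∞ (with the convention 1/∞ = 0), Γ_{q,p}(𝐪) = Γ_{p,p}(𝐪) + d(1/p − 1/q). -/

import Mathlib

open MeasureTheory
open scoped ENNReal

noncomputable section

namespace GOZZK

/-- A quadratic form in `d` real variables. -/
abbrev QF (d : ℕ) := QuadraticForm ℝ (Fin d → ℝ)

/-- The center of the dyadic subcube of `[0,1]^d` of side length `2⁻ᵏ` indexed by `ν`. -/
def center {d : ℕ} (k : ℕ) (ν : Fin d → Fin (2 ^ k)) : Fin d → ℝ :=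
  fun j => (ν j : ℕ) / 2 ^ k + 1 / 2 ^ (k + 1)

/-- The uncertainty parallelepiped `𝒰_□ = (a, 𝐪(a)) + L_□ᵀ([-C,C]^{d+n})` attached to the
cube of side `δ` centered at `a`; here `∇𝐪(a)ᵀ x = (polar Qᵢ (a, x))ᵢ`. -/
def Ubox {d n : ℕ} (Q : Fin n → QF d) (δ C : ℝ) (a : Fin d → ℝ) :
    Set ((Fin d → ℝ) × (Fin n → ℝ)) :=
  { z | ∃ (u : Fin d → ℝ) (v : Fin n → ℝ), (∀ j, |u j| ≤ C) ∧ (∀ i, |v i| ≤ C) ∧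
      z.1 = (fun j => a j + δ * u j) ∧
      z.2 = (fun i => Q i a + QuadraticMap.polar (⇑(Q i)) a (δ • u) + δ ^ 2 * v i) }

/-- The Fourier transform of a function on `ℝ^d × ℝⁿ`. -/
def fourierT {d n : ℕ} (f : ((Fin d → ℝ) × (Fin n → ℝ)) → ℂ)
    (ξ : (Fin d → ℝ) × (Fin n → ℝ)) : ℂ :=
  ∫ z : (Fin d → ℝ) × (Fin n → ℝ),
    Complex.exp (((-(2 * Real.pi * ((∑ j, z.1 j * ξ.1 j) + ∑ i, z.2 i * ξ.2 i)) : ℝ) : ℂ)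
      * Complex.I) * f z

/-- The `ℓ^q` norm of a finite tuple of extended nonnegative reals (interpreted as a
supremum when `q = ∞`). -/
def lqNorm {ι : Type*} [Fintype ι] (q : ℝ≥0∞) (a : ι → ℝ≥0∞) : ℝ≥0∞ :=
  if q = ∞ then ⨆ i, a i else (∑ i : ι, a i ^ q.toReal) ^ (1 / q.toReal)

/-- The `ℓ^q L^p` decoupling constant `Dec_{q,p}(𝐪, δ)` at scale `δ = 2⁻ᵏ`, with
uncertainty boxes of size parameter `C`: the smallest constant `D` such that
`‖∑_□ f_□‖_{L^p(ℝ^{d+n})} ≤ D (∑_□ ‖f_□‖_{L^p(ℝ^{d+n})}^q)^{1/q}` holds for every tuple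
of Schwartz functions `f_□` whose Fourier transform is supported in `𝒰_□`. -/
def DecConst {d n : ℕ} (Q : Fin n → QF d) (C : ℝ) (q p : ℝ≥0∞) (k : ℕ) : ℝ :=
  sInf { D : ℝ | 0 ≤ D ∧
    ∀ f : (Fin d → Fin (2 ^ k)) → SchwartzMap ((Fin d → ℝ) × (Fin n → ℝ)) ℂ,
      (∀ ν, Function.support (fourierT (⇑(f ν))) ⊆ Ubox Q (1 / 2 ^ k) C (center k ν)) →
      eLpNorm (fun z => ∑ ν, f ν z) p volume ≤
        ENNReal.ofReal D * lqNorm q (fun ν => eLpNorm (⇑(f ν)) p volume) }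

/-- The decoupling exponent `Γ_{q,p}(𝐪)`: the smallest `Γ` such that for every `ε > 0`
there is `C_ε` with `Dec_{q,p}(𝐪, δ) ≤ C_ε δ^{-Γ-ε}` for all dyadic `δ = 2⁻ᵏ < 1`. -/
def Gamma {d n : ℕ} (Q : Fin n → QF d) (C : ℝ) (q p : ℝ≥0∞) : ℝ :=
  sInf { G : ℝ | ∀ ε : ℝ, 0 < ε → ∃ Cε : ℝ, ∀ k : ℕ, 1 ≤ k →
    DecConst Q C q p k ≤ Cε * (1 / 2 ^ k : ℝ) ^ (-(G + ε)) }

/-- The linear part of the shear. -/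
def shB {d n : ℕ} (Q : Fin n → QF d) (b : Fin d → ℝ) (y : Fin n → ℝ) : Fin d → ℝ :=
  fun j => ∑ i, y i * QuadraticMap.polar (⇑(Q i)) b (Pi.single j 1)

/-- The affine symmetry. -/
def phi {d n : ℕ} (Q : Fin n → QF d) (b : Fin d → ℝ) (τ : Fin n → ℝ)
    (z : (Fin d → ℝ) × (Fin n → ℝ)) : (Fin d → ℝ) × (Fin n → ℝ) :=
  (z.1 + shB Q b z.2, z.2 - τ)

/-- The modulation. -/
def chi {d n : ℕ} (Q : Fin n → QF d) (b : Fin d → ℝ)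
    (z : (Fin d → ℝ) × (Fin n → ℝ)) : ℂ :=
  Complex.exp (((2 * Real.pi * ((∑ j, z.1 j * b j) + ∑ i, z.2 i * Q i b) : ℝ) : ℂ) * Complex.I)

lemma norm_chi {d n : ℕ} (Q : Fin n → QF d) (b : Fin d → ℝ) (z) : ‖chi Q b z‖ = 1 := by
  unfold chi
  exact Complex.norm_exp_ofReal_mul_I _

lemma polar_sum {d : ℕ} (Q : QF d) (b w : Fin d → ℝ) :
    ∑ j, QuadraticMap.polar (⇑Q) b (Pi.single j 1) * w j = QuadraticMap.polar (⇑Q) b w := by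
  have h : ∀ v, QuadraticMap.polar (⇑Q) b v = QuadraticMap.polarBilin Q b v := fun v => rfl
  simp only [h]
  conv_rhs => rw [pi_eq_sum_univ' w]
  rw [map_sum]
  refine Finset.sum_congr rfl fun j _ => ?_
  rw [map_smul, smul_eq_mul, mul_comm]

lemma temperate_exp : Function.HasTemperateGrowth
    (fun t : ℝ => Complex.exp ((t : ℂ) * Complex.I)) := by
  have hd : ∀ t : ℝ, HasDerivAt (fun t : ℝ => Complex.exp ((t : ℂ) * Complex.I))
      (Complex.exp ((t : ℂ) * Complex.I) * Complex.I) t := by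
    intro t
    have := ((Complex.ofRealCLM.hasDerivAt (x := t)).mul_const Complex.I).cexp
    simpa using this
  have hit : ∀ N : ℕ, iteratedDeriv N (fun t : ℝ => Complex.exp ((t : ℂ) * Complex.I))
      = fun t : ℝ => Complex.exp ((t : ℂ) * Complex.I) * Complex.I ^ N := by
    intro N
    induction N with
    | zero => simp
    | succ m ih =>
      rw [iteratedDeriv_succ, ih]
      ext t
      rw [((hd t).mul_const _).deriv]
      ring
  refine ⟨?_, fun N => ⟨0, 1, fun x => ?_⟩⟩
  · exact Complex.contDiff_exp.comp (Complex.ofRealCLM.contDiff.mul contDiff_const)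
  · rw [norm_iteratedFDeriv_eq_norm_iteratedDeriv, hit]
    simp [Complex.norm_exp_ofReal_mul_I]

lemma temperate_chi {d n : ℕ} (Q : Fin n → QF d) (b : Fin d → ℝ) :
    Function.HasTemperateGrowth (chi Q b) := by
  let L : ((Fin d → ℝ) × (Fin n → ℝ)) →ₗ[ℝ] ℝ :=
    { toFun := fun z => 2 * Real.pi * ((∑ j, z.1 j * b j) + ∑ i, z.2 i * Q i b)
      map_add' := by
        intro x y
        simp [add_mul, Finset.sum_add_distrib]
        ring
      map_smul' := by
        intro c x
        simp [mul_assoc, ← Finset.mul_sum]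
        ring }
  exact temperate_exp.comp (LinearMap.toContinuousLinearMap L).hasTemperateGrowth

/-- The shear as a linear equivalence. -/
def shL {d n : ℕ} (Q : Fin n → QF d) (b : Fin d → ℝ) :
    ((Fin d → ℝ) × (Fin n → ℝ)) ≃ₗ[ℝ] ((Fin d → ℝ) × (Fin n → ℝ)) where
  toFun z := (z.1 + shB Q b z.2, z.2)
  invFun z := (z.1 - shB Q b z.2, z.2)
  left_inv z := by simp
  right_inv z := by simp
  map_add' x y := by
    ext j
    · simp [shB, add_mul, Finset.sum_add_distrib]
      ring
    · simp
  map_smul' c x := by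
    ext j
    · simp [shB, Finset.mul_sum, mul_assoc]
    · simp

/-- The symmetry operator on Schwartz functions. -/
def Usch {d n : ℕ} (Q : Fin n → QF d) (b : Fin d → ℝ) (τ : Fin n → ℝ) :
    SchwartzMap ((Fin d → ℝ) × (Fin n → ℝ)) ℂ →L[ℂ]
      SchwartzMap ((Fin d → ℝ) × (Fin n → ℝ)) ℂ :=
  (SchwartzMap.smulLeftCLM ℂ (chi Q b)).comp
    ((SchwartzMap.compCLMOfContinuousLinearEquiv ℂ (shL Q b).toContinuousLinearEquiv).comp
      (SchwartzMap.compSubConstCLM ℂ ((0, τ) : (Fin d → ℝ) × (Fin n → ℝ))))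

lemma Usch_apply {d n : ℕ} (Q : Fin n → QF d) (b : Fin d → ℝ) (τ : Fin n → ℝ)
    (f : SchwartzMap ((Fin d → ℝ) × (Fin n → ℝ)) ℂ) (z) :
    Usch Q b τ f z = chi Q b z * f (phi Q b τ z) := by
  simp only [Usch, ContinuousLinearMap.comp_apply]
  rw [SchwartzMap.smulLeftCLM_apply_apply (temperate_chi Q b)]
  simp [phi, shL]

lemma continuous_shB {d n : ℕ} (Q : Fin n → QF d) (b : Fin d → ℝ) : Continuous (shB Q b) := by
  unfold shB
  fun_prop

lemma phi_mp {d n : ℕ} (Q : Fin n → QF d) (b : Fin d → ℝ) (τ : Fin n → ℝ) :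
    MeasurePreserving (phi Q b τ) volume volume := by
  have h1 : MeasurePreserving
      (fun p : (Fin n → ℝ) × (Fin d → ℝ) => (p.1 - τ, p.2 + shB Q b p.1))
      (volume.prod volume) (volume.prod volume) := by
    refine MeasurePreserving.skew_product (f := fun y => y - τ)
      (g := fun y x => x + shB Q b y) (measurePreserving_sub_right volume τ) ?_ ?_
    · have := continuous_shB Q b
      exact Continuous.measurable (by fun_prop)
    · exact Filter.Eventually.of_forall fun y => map_add_right_eq_self volume _
  exact (Measure.measurePreserving_swap.comp h1).comp Measure.measurePreserving_swap

lemma continuous_phi {d n : ℕ} (Q : Fin n → QF d) (b : Fin d → ℝ) (τ : Fin n → ℝ) :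
    Continuous (phi Q b τ) := by
  have := continuous_shB Q b
  unfold phi
  fun_prop

lemma fourierT_Usch {d n : ℕ} (Q : Fin n → QF d) (b : Fin d → ℝ) (τ : Fin n → ℝ)
    (f : SchwartzMap ((Fin d → ℝ) × (Fin n → ℝ)) ℂ) (ξ : (Fin d → ℝ) × (Fin n → ℝ)) :
    ∃ c : ℂ, fourierT (⇑(Usch Q b τ f)) ξ = c * fourierT (⇑f) (ξ.1 - b,
      fun i => ξ.2 i - Q i b - QuadraticMap.polar (⇑(Q i)) b (ξ.1 - b)) := by
  set η : (Fin d → ℝ) × (Fin n → ℝ) := (ξ.1 - b,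
      fun i => ξ.2 i - Q i b - QuadraticMap.polar (⇑(Q i)) b (ξ.1 - b)) with hη
  refine ⟨Complex.exp (((-(2 * Real.pi * (∑ i, τ i * η.2 i)) : ℝ) : ℂ) * Complex.I), ?_⟩
  unfold fourierT
  rw [← integral_const_mul]
  set F : (Fin d → ℝ) × (Fin n → ℝ) → ℂ := fun z =>
    Complex.exp (((-(2 * Real.pi * (∑ i, τ i * η.2 i)) : ℝ) : ℂ) * Complex.I) *
     (Complex.exp (((-(2 * Real.pi * ((∑ j, z.1 j * η.1 j) + ∑ i, z.2 i * η.2 i)) : ℝ) : ℂ)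
      * Complex.I) * f z) with hF
  have hFc : Continuous F := by
    have := f.continuous
    fun_prop
  have hmp := phi_mp Q b τ
  have h2 : ∫ z, F z = ∫ z, F (phi Q b τ z) := by
    conv_lhs => rw [← hmp.map_eq]
    exact integral_map hmp.aemeasurable hFc.aestronglyMeasurable
  rw [h2]
  refine integral_congr_ae (Filter.Eventually.of_forall fun z => ?_)
  simp only [hF, Usch_apply, chi, ← mul_assoc, ← Complex.exp_add]
  congr 2
  simp only [← add_mul, ← Complex.ofReal_add]
  congr 2
  have h3 : ∑ j, shB Q b z.2 j * η.1 j
      = ∑ i, z.2 i * QuadraticMap.polar (⇑(Q i)) b (ξ.1 - b) := by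
    have h3' : ∀ i, z.2 i * QuadraticMap.polar (⇑(Q i)) b (ξ.1 - b) = ∑ j,
        z.2 i * QuadraticMap.polar (⇑(Q i)) b (Pi.single j 1) * η.1 j := by
      intro i
      rw [← polar_sum, Finset.mul_sum]
      simp only [hη, mul_assoc]
    simp only [h3', shB, Finset.sum_mul]
    rw [Finset.sum_comm]
  have h4 : ∑ j, (phi Q b τ z).1 j * η.1 j = (∑ j, z.1 j * ξ.1 j) - (∑ j, z.1 j * b j)
      + ∑ i, z.2 i * QuadraticMap.polar (⇑(Q i)) b (ξ.1 - b) := by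
    rw [← h3, ← Finset.sum_sub_distrib, ← Finset.sum_add_distrib]
    refine Finset.sum_congr rfl fun j _ => ?_
    simp [phi, hη]
    ring
  have h5 : ∑ i, (phi Q b τ z).2 i * η.2 i = (∑ i, z.2 i * ξ.2 i) - (∑ i, z.2 i * Q i b)
      - (∑ i, z.2 i * QuadraticMap.polar (⇑(Q i)) b (ξ.1 - b)) - ∑ i, τ i * η.2 i := by
    rw [← Finset.sum_sub_distrib, ← Finset.sum_sub_distrib, ← Finset.sum_sub_distrib]
    refine Finset.sum_congr rfl fun j _ => ?_
    simp [phi, hη]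
    ring
  rw [h4, h5]
  ring

lemma support_Usch {d n : ℕ} (Q : Fin n → QF d) (b : Fin d → ℝ) (τ : Fin n → ℝ)
    (f : SchwartzMap ((Fin d → ℝ) × (Fin n → ℝ)) ℂ) (δ C : ℝ) (a : Fin d → ℝ)
    (h : Function.support (fourierT (⇑f)) ⊆ Ubox Q δ C a) :
    Function.support (fourierT (⇑(Usch Q b τ f))) ⊆ Ubox Q δ C (a + b) := by
  intro ξ hξ
  obtain ⟨c, hc⟩ := fourierT_Usch Q b τ f ξ
  have h1 : fourierT (⇑f) (ξ.1 - b,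
      fun i => ξ.2 i - Q i b - QuadraticMap.polar (⇑(Q i)) b (ξ.1 - b)) ≠ 0 := by
    intro h0
    rw [h0, mul_zero] at hc
    exact hξ hc
  obtain ⟨u, v, hu, hv, h2, h3⟩ := h h1
  refine ⟨u, v, hu, hv, ?_, ?_⟩
  · ext j
    have := congrFun h2 j
    simp at this ⊢
    linarith
  · ext i
    have h4 := congrFun h3 i
    have h5 : ξ.1 - b = a + δ • u := by
      rw [show ξ.1 - b = _ from h2]
      ext j
      simp
    simp only [h5, QuadraticMap.polar_add_right, QuadraticMap.polar_add_left] at h4 ⊢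
    have h6 : Q i (a + b) = Q i a + Q i b + QuadraticMap.polar (⇑(Q i)) b a := by
      rw [QuadraticMap.polar_comm, QuadraticMap.map_add (Q i)]
    rw [h6]
    linarith

lemma lqNorm_mono {ι : Type*} [Fintype ι] (q : ℝ≥0∞) {a b : ι → ℝ≥0∞} (h : ∀ i, a i ≤ b i) :
    lqNorm q a ≤ lqNorm q b := by
  unfold lqNorm
  split_ifs
  · exact iSup_mono h
  · refine ENNReal.rpow_le_rpow (Finset.sum_le_sum fun i _ => ?_) (by positivity)
    exact ENNReal.rpow_le_rpow (h i) ENNReal.toReal_nonneg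

lemma lqNorm_const_le {ι : Type*} [Fintype ι] (q : ℝ≥0∞) (hq : q ≠ 0) (x : ℝ≥0∞) :
    lqNorm q (fun _ : ι => x) ≤ (Fintype.card ι : ℝ≥0∞) ^ (1 / q.toReal) * x := by
  unfold lqNorm
  split_ifs with h
  · subst h
    simp [iSup_le_iff]
  · have h0 : 0 < q.toReal := ENNReal.toReal_pos hq h
    rw [Finset.sum_const, nsmul_eq_mul, ENNReal.mul_rpow_of_nonneg _ _ (by positivity),
      ← ENNReal.rpow_mul, mul_one_div_cancel h0.ne', ENNReal.rpow_one]
    simp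

lemma lqNorm_add_le {ι : Type*} [Fintype ι] (p : ℝ≥0∞) (hp : 1 ≤ p) (hp' : p ≠ ∞)
    (a b : ι → ℝ≥0∞) :
    lqNorm p (fun i => a i + b i) ≤ lqNorm p a + lqNorm p b := by
  simp only [lqNorm, if_neg hp']
  refine ENNReal.Lp_add_le _ _ _ ?_
  rw [← ENNReal.toReal_one]
  exact (ENNReal.toReal_le_toReal ENNReal.one_ne_top hp').2 hp

lemma eLpNorm_disj {E A : Type*} [MeasurableSpace E] [Fintype A] (μ : Measure E)
    (p : ℝ≥0∞) (hp : p ≠ 0) (hp' : p ≠ ∞) (f : A → E → ℂ)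
    (hf : ∀ a, AEStronglyMeasurable (f a) μ)
    (hdis : ∀ z a a', f a z ≠ 0 → f a' z ≠ 0 → a = a') :
    eLpNorm (fun z => ∑ a, f a z) p μ = lqNorm p (fun a => eLpNorm (f a) p μ) := by
  have h0 : 0 < p.toReal := ENNReal.toReal_pos hp hp'
  simp only [lqNorm, if_neg hp', eLpNorm_eq_lintegral_rpow_enorm_toReal hp hp']
  congr 1
  have h1 : ∀ a, ((∫⁻ x, ‖f a x‖ₑ ^ p.toReal ∂μ) ^ (1 / p.toReal)) ^ p.toReal
      = ∫⁻ x, ‖f a x‖ₑ ^ p.toReal ∂μ := by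
    intro a
    rw [← ENNReal.rpow_mul, one_div_mul_cancel h0.ne', ENNReal.rpow_one]
  simp only [h1]
  rw [← lintegral_finsetSum']
  · refine lintegral_congr fun z => ?_
    by_cases hz : ∃ a, f a z ≠ 0
    · obtain ⟨a, ha⟩ := hz
      have hz' : ∀ a', a' ≠ a → f a' z = 0 := by
        intro a' h
        by_contra h2
        exact h (hdis z a' a h2 ha)
      rw [Finset.sum_eq_single a (fun a' _ h => hz' a' h) (by simp),
        Finset.sum_eq_single a (fun a' _ h => by simp [hz' a' h, h0]) (by simp)]
    · push Not at hz
      simp [hz, h0]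
  · intro a _
    exact (hf a).enorm.pow_const _

lemma eLpNorm_U {d n : ℕ} (Q : Fin n → QF d) (b : Fin d → ℝ) (τ : Fin n → ℝ) (p : ℝ≥0∞)
    (F : (Fin d → ℝ) × (Fin n → ℝ) → ℂ) (hF : AEStronglyMeasurable F volume) :
    eLpNorm (fun z => chi Q b z * F (phi Q b τ z)) p volume = eLpNorm F p volume := by
  rw [← eLpNorm_comp_measurePreserving hF (phi_mp Q b τ)]
  refine eLpNorm_congr_norm_ae (Filter.Eventually.of_forall fun z => ?_)
  simp [norm_chi]

lemma continuous_chi {d n : ℕ} (Q : Fin n → QF d) (b : Fin d → ℝ) : Continuous (chi Q b) := by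
  unfold chi
  fun_prop

lemma aesm_U {d n : ℕ} (Q : Fin n → QF d) (b : Fin d → ℝ) (τ : Fin n → ℝ)
    (F : (Fin d → ℝ) × (Fin n → ℝ) → ℂ) (hF : AEStronglyMeasurable F volume) :
    AEStronglyMeasurable (fun z => chi Q b z * F (phi Q b τ z)) volume :=
  (continuous_chi Q b).aestronglyMeasurable.mul (hF.comp_measurePreserving (phi_mp Q b τ))

lemma separation {d n : ℕ} (hn : 1 ≤ n) (Q : Fin n → QF d) {A J : Type*} [Fintype A] [Fintype J]
    (p : ℝ≥0∞) (hp : 1 ≤ p) (hp' : p ≠ ∞) (b : A → Fin d → ℝ)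
    (F : A → J → (Fin d → ℝ) × (Fin n → ℝ) → ℂ) (hF : ∀ a j, MemLp (F a j) p volume)
    (ε : ℝ≥0∞) (hε : ε ≠ 0) :
    ∃ τ : A → Fin n → ℝ, ∀ j,
      eLpNorm (fun z => ∑ a, chi Q (b a) z * F a j (phi Q (b a) (τ a) z)) p volume
        ≤ lqNorm p (fun a => eLpNorm (F a j) p volume) + ε ∧
      lqNorm p (fun a => eLpNorm (F a j) p volume) ≤
        eLpNorm (fun z => ∑ a, chi Q (b a) z * F a j (phi Q (b a) (τ a) z)) p volume + ε := by
  have hp0 : p ≠ 0 := (zero_lt_one.trans_le hp).ne'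
  set K : ℝ≥0∞ := (Fintype.card A : ℝ≥0∞) ^ (1 / p.toReal) + Fintype.card A with hK
  have hKt : K + 1 ≠ ∞ := by
    have : (Fintype.card A : ℝ≥0∞) ^ (1 / p.toReal) ≠ ∞ :=
      ENNReal.rpow_ne_top_of_nonneg (by positivity) (ENNReal.natCast_ne_top _)
    simp [hK]
  set e : ℝ≥0∞ := ε / (K + 1) with he
  have he0 : e ≠ 0 := (ENNReal.div_pos hε hKt).ne'
  have hKe : K * e ≤ ε := by
    calc K * e ≤ (K + 1) * e := by gcongr; exact le_self_add
      _ ≤ ε := ENNReal.mul_div_le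
  have happ := fun a j => (hF a j).exists_hasCompactSupport_eLpNorm_sub_le hp' he0
  choose G hGc hGe hGcont hGm using happ
  obtain ⟨R, hR⟩ : ∃ R : ℝ, ∀ a j z, G a j z ≠ 0 → ‖z‖ ≤ R := by
    have h1 : ∀ a j, ∃ R : ℝ, ∀ z, G a j z ≠ 0 → ‖z‖ ≤ R := by
      intro a j
      obtain ⟨R, hR⟩ := (hGc a j).isCompact.isBounded.exists_norm_le
      exact ⟨R, fun z hz => hR z (subset_tsupport _ hz)⟩
    choose R hR using h1
    refine ⟨∑ a, ∑ j, |R a j|, fun a j z hz => (hR a j z hz).trans ?_⟩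
    calc R a j ≤ |R a j| := le_abs_self _
      _ ≤ ∑ j, |R a j| := Finset.single_le_sum (f := fun j => |R a j|)
          (fun _ _ => abs_nonneg _) (Finset.mem_univ j)
      _ ≤ _ := Finset.single_le_sum (f := fun a => ∑ j, |R a j|)
          (fun _ _ => Finset.sum_nonneg fun _ _ => abs_nonneg _) (Finset.mem_univ a)
  let idx : A → ℕ := fun a => (Fintype.equivFin A a : ℕ)
  have hidx : Function.Injective idx := fun a a' h =>
    (Fintype.equivFin A).injective (Fin.ext h)
  let τ : A → Fin n → ℝ := fun a _ => (2 * |R| + 1) * idx a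
  have i0 : Fin n := ⟨0, hn⟩
  refine ⟨τ, fun j => ?_⟩
  have hdis : ∀ z a a', chi Q (b a) z * G a j (phi Q (b a) (τ a) z) ≠ 0 →
      chi Q (b a') z * G a' j (phi Q (b a') (τ a') z) ≠ 0 → a = a' := by
    intro z a a' h h'
    have h1 : ∀ a, chi Q (b a) z * G a j (phi Q (b a) (τ a) z) ≠ 0 →
        |z.2 i0 - (2 * |R| + 1) * idx a| ≤ |R| := by
      intro a h
      have h2 := hR a j _ (right_ne_zero_of_mul h)
      have h3 : ‖(phi Q (b a) (τ a) z).2 i0‖ ≤ R :=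
        (norm_le_pi_norm _ i0).trans ((norm_snd_le _).trans h2)
      exact h3.trans (le_abs_self R)
    have h2 := abs_le.1 (h1 a h)
    have h3 := abs_le.1 (h1 a' h')
    apply hidx
    have hR0 : 0 ≤ |R| := abs_nonneg R
    by_contra hne
    rcases lt_or_gt_of_ne hne with hlt | hlt
    · have : (idx a : ℝ) + 1 ≤ idx a' := by exact_mod_cast hlt
      nlinarith
    · have : (idx a' : ℝ) + 1 ≤ idx a := by exact_mod_cast hlt
      nlinarith
  have hGU := eLpNorm_disj volume p hp0 hp'
    (fun a z => chi Q (b a) z * G a j (phi Q (b a) (τ a) z))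
    (fun a => aesm_U Q (b a) (τ a) _ (hGm a j).1) hdis
  simp only [eLpNorm_U Q _ _ p _ (hGm _ j).1] at hGU
  set SF : (Fin d → ℝ) × (Fin n → ℝ) → ℂ :=
    fun z => ∑ a, chi Q (b a) z * F a j (phi Q (b a) (τ a) z) with hSF
  set SG : (Fin d → ℝ) × (Fin n → ℝ) → ℂ :=
    fun z => ∑ a, chi Q (b a) z * G a j (phi Q (b a) (τ a) z) with hSG
  have hSFm : AEStronglyMeasurable SF volume := by
    have := Finset.aestronglyMeasurable_sum (μ := volume) (Finset.univ : Finset A)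
      (f := fun a z => chi Q (b a) z * F a j (phi Q (b a) (τ a) z))
      (fun a _ => aesm_U Q (b a) (τ a) _ (hF a j).1)
    have h2 : SF = ∑ a, fun z => chi Q (b a) z * F a j (phi Q (b a) (τ a) z) := by
      ext z
      simp [hSF]
    rw [h2]
    exact this
  have hSGm : AEStronglyMeasurable SG volume := by
    have := Finset.aestronglyMeasurable_sum (μ := volume) (Finset.univ : Finset A)
      (f := fun a z => chi Q (b a) z * G a j (phi Q (b a) (τ a) z))
      (fun a _ => aesm_U Q (b a) (τ a) _ (hGm a j).1)
    have h2 : SG = ∑ a, fun z => chi Q (b a) z * G a j (phi Q (b a) (τ a) z) := by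
      ext z
      simp [hSG]
    rw [h2]
    exact this
  have hdiff : eLpNorm (SF - SG) p volume ≤ Fintype.card A * e := by
    have h1 : SF - SG = ∑ a, fun z => chi Q (b a) z * (F a j - G a j) (phi Q (b a) (τ a) z) := by
      ext z
      simp [hSF, hSG, mul_sub]
    rw [h1]
    refine (eLpNorm_sum_le (fun a _ => aesm_U Q (b a) (τ a) _ ((hF a j).1.sub (hGm a j).1))
      hp).trans ?_
    calc _ ≤ ∑ a : A, e := by
          refine Finset.sum_le_sum fun a _ => ?_
          rw [eLpNorm_U Q _ _ p _ ((hF a j).1.sub (hGm a j).1)]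
          exact hGe a j
      _ = _ := by simp
  have hconst := lqNorm_const_le (ι := A) p hp0 e
  have hFG : lqNorm p (fun a => eLpNorm (F a j) p volume) ≤
      lqNorm p (fun a => eLpNorm (G a j) p volume)
        + (Fintype.card A : ℝ≥0∞) ^ (1 / p.toReal) * e := by
    refine le_trans (lqNorm_mono p (b := fun a => eLpNorm (G a j) p volume + e) fun a => ?_)
      ((lqNorm_add_le p hp hp' _ _).trans (by gcongr))
    have h1 : F a j = G a j + (F a j - G a j) := by simp
    rw [h1]
    exact (eLpNorm_add_le (hGm a j).1 ((hF a j).1.sub (hGm a j).1) hp).trans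
      (by gcongr; exact hGe a j)
  have hGF : lqNorm p (fun a => eLpNorm (G a j) p volume) ≤
      lqNorm p (fun a => eLpNorm (F a j) p volume)
        + (Fintype.card A : ℝ≥0∞) ^ (1 / p.toReal) * e := by
    refine le_trans (lqNorm_mono p (b := fun a => eLpNorm (F a j) p volume + e) fun a => ?_)
      ((lqNorm_add_le p hp hp' _ _).trans (by gcongr))
    have h1 : G a j = F a j - (F a j - G a j) := by simp
    rw [h1]
    exact (eLpNorm_sub_le (hF a j).1 ((hF a j).1.sub (hGm a j).1) hp).trans
      (by gcongr; exact hGe a j)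
  have hS1 : eLpNorm SF p volume ≤ eLpNorm SG p volume + Fintype.card A * e := by
    have h1 : SF = SG + (SF - SG) := by simp
    rw [h1]
    exact (eLpNorm_add_le hSGm (hSFm.sub hSGm) hp).trans (by gcongr)
  have hS2 : eLpNorm SG p volume ≤ eLpNorm SF p volume + Fintype.card A * e := by
    have h1 : SG = SF - (SF - SG) := by simp
    rw [h1]
    exact (eLpNorm_sub_le hSFm (hSFm.sub hSGm) hp).trans (by gcongr)
  rw [hK, add_mul] at hKe
  constructor
  · calc eLpNorm SF p volume ≤ eLpNorm SG p volume + Fintype.card A * e := hS1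
      _ ≤ lqNorm p (fun a => eLpNorm (F a j) p volume)
        + (Fintype.card A : ℝ≥0∞) ^ (1 / p.toReal) * e + Fintype.card A * e := by
          rw [hGU]; gcongr
      _ ≤ _ := by rw [add_assoc]; gcongr
  · calc _ ≤ lqNorm p (fun a => eLpNorm (G a j) p volume)
        + (Fintype.card A : ℝ≥0∞) ^ (1 / p.toReal) * e := hFG
      _ ≤ eLpNorm SF p volume + Fintype.card A * e
        + (Fintype.card A : ℝ≥0∞) ^ (1 / p.toReal) * e := by
          rw [← hGU]; gcongr
      _ ≤ _ := by rw [add_assoc, add_comm ((Fintype.card A : ℝ≥0∞) * e)]; gcongr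

instance instHaarVol {d n : ℕ} :
    (volume : Measure ((Fin d → ℝ) × (Fin n → ℝ))).IsAddHaarMeasure :=
  Measure.prod.instIsAddHaarMeasure volume volume

/-- The set of admissible decoupling constants. -/
def Good {d n : ℕ} (Q : Fin n → QF d) (C : ℝ) (q p : ℝ≥0∞) (k : ℕ) : Set ℝ :=
  { D : ℝ | 0 ≤ D ∧
    ∀ f : (Fin d → Fin (2 ^ k)) → SchwartzMap ((Fin d → ℝ) × (Fin n → ℝ)) ℂ,
      (∀ ν, Function.support (fourierT (⇑(f ν))) ⊆ Ubox Q (1 / 2 ^ k) C (center k ν)) →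
      eLpNorm (fun z => ∑ ν, f ν z) p volume ≤
        ENNReal.ofReal D * lqNorm q (fun ν => eLpNorm (⇑(f ν)) p volume) }

lemma DecConst_eq {d n : ℕ} (Q : Fin n → QF d) (C : ℝ) (q p : ℝ≥0∞) (k : ℕ) :
    DecConst Q C q p k = sInf (Good Q C q p k) := rfl

lemma lqNorm_const {ι : Type*} [Fintype ι] (q : ℝ≥0∞) (hq : q ≠ 0) (hq' : q ≠ ∞) (x : ℝ≥0∞) :
    lqNorm q (fun _ : ι => x) = (Fintype.card ι : ℝ≥0∞) ^ (1 / q.toReal) * x := by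
  have h0 : 0 < q.toReal := ENNReal.toReal_pos hq hq'
  rw [lqNorm, if_neg hq', Finset.sum_const, nsmul_eq_mul,
    ENNReal.mul_rpow_of_nonneg _ _ (by positivity),
    ← ENNReal.rpow_mul, mul_one_div_cancel h0.ne', ENNReal.rpow_one]
  simp

lemma integrable_fourier {d n : ℕ} (f : SchwartzMap ((Fin d → ℝ) × (Fin n → ℝ)) ℂ)
    (ξ : (Fin d → ℝ) × (Fin n → ℝ)) :
    Integrable (fun z : (Fin d → ℝ) × (Fin n → ℝ) =>
      Complex.exp (((-(2 * Real.pi * ((∑ j, z.1 j * ξ.1 j) + ∑ i, z.2 i * ξ.2 i)) : ℝ) : ℂ)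
      * Complex.I) * f z) := by
  refine (f.integrable (μ := volume)).bdd_mul (c := 1) ?_ ?_
  · exact Continuous.aestronglyMeasurable (by fun_prop)
  · exact Filter.Eventually.of_forall fun z => (Complex.norm_exp_ofReal_mul_I _).le

lemma fourierT_sum {d n : ℕ} {A : Type*} [Fintype A]
    (f : A → SchwartzMap ((Fin d → ℝ) × (Fin n → ℝ)) ℂ) (ξ : (Fin d → ℝ) × (Fin n → ℝ)) :
    fourierT (⇑(∑ a, f a)) ξ = ∑ a, fourierT (⇑(f a)) ξ := by
  unfold fourierT
  rw [← integral_finsetSum _ (fun a _ => integrable_fourier (f a) ξ)]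
  refine integral_congr_ae (Filter.Eventually.of_forall fun z => ?_)
  simp [Finset.mul_sum]

lemma fourierT_zero {d n : ℕ} (ξ : (Fin d → ℝ) × (Fin n → ℝ)) :
    fourierT (⇑(0 : SchwartzMap ((Fin d → ℝ) × (Fin n → ℝ)) ℂ)) ξ = 0 := by
  simp [fourierT]

lemma core {d n : ℕ} (hn : 1 ≤ n) (Q : Fin n → QF d) (Cb : ℝ) (q p : ℝ≥0∞) (hq : q ≠ 0)
    (hp : 1 ≤ p) (hp' : p ≠ ∞) (k : ℕ) (D : ℝ) (hD : D ∈ Good Q Cb q p k)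
    {A C : Type*} [Fintype A] [Fintype C]
    (idx : C → A → (Fin d → Fin (2 ^ k)))
    (hi1 : ∀ c a a', idx c a = idx c a' → a = a')
    (hi2 : ∀ c c' a, idx c a = idx c' a → c = c')
    (b : A → Fin d → ℝ) (cen : C → Fin d → ℝ)
    (hcen : ∀ c a, center k (idx c a) = cen c + b a)
    (h : C → SchwartzMap ((Fin d → ℝ) × (Fin n → ℝ)) ℂ)
    (hs : ∀ c, Function.support (fourierT (⇑(h c))) ⊆ Ubox Q (1 / 2 ^ k) Cb (cen c)) :
    (Fintype.card A : ℝ≥0∞) ^ (1 / p.toReal) * eLpNorm (fun z => ∑ c, h c z) p volume ≤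
      ENNReal.ofReal D * (Fintype.card (Fin d → Fin (2 ^ k)) : ℝ≥0∞) ^ (1 / q.toReal) *
        lqNorm p (fun c => eLpNorm (⇑(h c)) p volume) := by
  classical
  have hp0 : p ≠ 0 := (zero_lt_one.trans_le hp).ne'
  have hpr : 0 < p.toReal := ENNReal.toReal_pos hp0 hp'
  set X := lqNorm p (fun c => eLpNorm (⇑(h c)) p volume) with hX
  set N := (Fintype.card (Fin d → Fin (2 ^ k)) : ℝ≥0∞) ^ (1 / q.toReal) with hN
  have hNt : N ≠ ∞ := ENNReal.rpow_ne_top_of_nonneg (by positivity) (ENNReal.natCast_ne_top _)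
  let F : A → (Fin d → Fin (2 ^ k)) → SchwartzMap ((Fin d → ℝ) × (Fin n → ℝ)) ℂ :=
    fun a μ => ∑ c, if μ = idx c a then h c else 0
  let F0 : SchwartzMap ((Fin d → ℝ) × (Fin n → ℝ)) ℂ := ∑ c, h c
  have hFsum : ∀ a, ∑ μ, F a μ = F0 := by
    intro a
    simp only [F, F0]
    rw [Finset.sum_comm]
    simp
  have hF1 : ∀ a c, F a (idx c a) = h c := by
    intro a c
    simp only [F]
    rw [Finset.sum_eq_single c]
    · simp
    · intro c' _ hc
      rw [if_neg]
      intro h1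
      exact hc (hi2 _ _ _ h1).symm
    · simp
  have hF2 : ∀ a μ, (∀ c, μ ≠ idx c a) → F a μ = 0 := by
    intro a μ hμ
    simp only [F]
    exact Finset.sum_eq_zero fun c _ => if_neg (hμ c)
  have hFn : ∀ μ, lqNorm p (fun a => eLpNorm (⇑(F a μ)) p volume) ≤ X := by
    intro μ
    simp only [hX, lqNorm, if_neg hp']
    refine ENNReal.rpow_le_rpow ?_ (by positivity)
    have h1 : ∀ a, eLpNorm (⇑(F a μ)) p volume ^ p.toReal ≤
        ∑ c, if μ = idx c a then eLpNorm (⇑(h c)) p volume ^ p.toReal else 0 := by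
      intro a
      by_cases hμ : ∃ c, μ = idx c a
      · obtain ⟨c, rfl⟩ := hμ
        rw [hF1]
        have := Finset.single_le_sum (s := Finset.univ) (f := fun c' => if idx c a = idx c' a then
          eLpNorm (⇑(h c')) p volume ^ p.toReal else 0) (fun _ _ => zero_le) (Finset.mem_univ c)
        simpa using this
      · push Not at hμ
        rw [hF2 a μ hμ]
        simp [hpr]
    refine (Finset.sum_le_sum fun a _ => h1 a).trans ?_
    rw [Finset.sum_comm]
    refine Finset.sum_le_sum fun c _ => ?_
    by_cases hμ : ∃ a, μ = idx c a
    · obtain ⟨a, rfl⟩ := hμ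
      rw [Finset.sum_eq_single a]
      · simp
      · intro a' _ ha
        rw [if_neg]
        intro h1
        exact ha (hi1 _ _ _ h1).symm
      · simp
    · push Not at hμ
      simp [hμ]
  have key : ∀ ε : ℝ≥0∞, ε ≠ 0 →
      (Fintype.card A : ℝ≥0∞) ^ (1 / p.toReal) * eLpNorm (⇑F0) p volume ≤
      ENNReal.ofReal D * (N * (X + ε)) + ε := by
    intro ε hε
    obtain ⟨τ, hτ⟩ := separation hn Q (A := A) (J := Option (Fin d → Fin (2 ^ k))) p hp hp' b
      (fun a j => match j with
        | none => ⇑F0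
        | some μ => ⇑(F a μ))
      (fun a j => by cases j <;> exact SchwartzMap.memLp _ p volume) ε hε
    let G : (Fin d → Fin (2 ^ k)) → SchwartzMap ((Fin d → ℝ) × (Fin n → ℝ)) ℂ :=
      fun μ => ∑ a, Usch Q (b a) (τ a) (F a μ)
    have hGs : ∀ μ, Function.support (fourierT (⇑(G μ))) ⊆
        Ubox Q (1 / 2 ^ k) Cb (center k μ) := by
      intro μ ξ hξ
      by_contra hno
      apply hξ
      simp only [G]
      rw [fourierT_sum]
      refine Finset.sum_eq_zero fun a _ => ?_
      by_cases hμ : ∃ c, μ = idx c a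
      · obtain ⟨c, rfl⟩ := hμ
        by_contra hne
        apply hno
        rw [hF1] at hne
        rw [hcen]
        exact support_Usch Q (b a) (τ a) (h c) _ _ _ (hs c) hne
      · push Not at hμ
        rw [hF2 a μ hμ, map_zero, fourierT_zero]
    have hG := hD.2 G hGs
    have hGz : ∀ μ z, G μ z = ∑ a, chi Q (b a) z * F a μ (phi Q (b a) (τ a) z) := by
      intro μ z
      simp only [G, sum_apply, Usch_apply]
    have hGsum : (fun z => ∑ μ, G μ z) =
        fun z => ∑ a, chi Q (b a) z * F0 (phi Q (b a) (τ a) z) := by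
      ext z
      simp only [hGz]
      rw [Finset.sum_comm]
      refine Finset.sum_congr rfl fun a _ => ?_
      rw [← Finset.mul_sum, ← hFsum a, sum_apply]
    have hGμ : ∀ μ, eLpNorm (⇑(G μ)) p volume ≤ X + ε := by
      intro μ
      have h1 := (hτ (some μ)).1
      rw [show (⇑(G μ)) = fun z => ∑ a, chi Q (b a) z * F a μ (phi Q (b a) (τ a) z) from
        funext (hGz μ)]
      exact h1.trans (by gcongr; exact hFn μ)
    have h2 : lqNorm p (fun _ : A => eLpNorm (⇑F0) p volume) ≤
        eLpNorm (fun z => ∑ a, chi Q (b a) z * F0 (phi Q (b a) (τ a) z)) p volume + ε :=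
      (hτ none).2
    rw [lqNorm_const p hp0 hp'] at h2
    refine h2.trans ?_
    gcongr
    have h3 : eLpNorm (fun z => ∑ a, chi Q (b a) z * F0 (phi Q (b a) (τ a) z)) p volume ≤ _ :=
      hGsum ▸ hG
    refine h3.trans ?_
    gcongr
    exact (lqNorm_mono q hGμ).trans (lqNorm_const_le q hq _)
  have hF0 : (fun z => ∑ c, h c z) = ⇑F0 := by
    ext z
    simp [F0]
  rw [hF0]
  refine ENNReal.le_of_forall_pos_le_add fun e he _ => ?_
  set L : ℝ≥0∞ := ENNReal.ofReal D * N + 1 with hL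
  have hLt : L ≠ ∞ := by
    simp [hL, ENNReal.mul_eq_top, hNt]
  refine (key (e / L) (ENNReal.div_pos (by exact_mod_cast he.ne') hLt).ne').trans ?_
  calc _ = ENNReal.ofReal D * N * X + L * (e / L) := by rw [hL]; ring
    _ ≤ _ := by gcongr; exact ENNReal.mul_div_le

lemma exists_bump {d n : ℕ} (r : ℝ) (hr : 0 < r) :
    ∃ h : SchwartzMap ((Fin d → ℝ) × (Fin n → ℝ)) ℂ, h ≠ 0 ∧
      ∀ ξ, fourierT (⇑h) ξ ≠ 0 → ‖ξ‖ ≤ r := by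
  let W := WithLp 2 (EuclideanSpace ℝ (Fin d) × EuclideanSpace ℝ (Fin n))
  let e : ((Fin d → ℝ) × (Fin n → ℝ)) ≃L[ℝ] W :=
    ((EuclideanSpace.equiv (Fin d) ℝ).symm.prodCongr (EuclideanSpace.equiv (Fin n) ℝ).symm).trans
      (WithLp.prodContinuousLinearEquiv 2 ℝ _ _).symm
  have he : MeasurePreserving e volume volume := by
    have h1 : MeasurePreserving (fun z : (Fin d → ℝ) × (Fin n → ℝ) =>
        (Prod.map (WithLp.toLp 2) (WithLp.toLp 2) z :
          EuclideanSpace ℝ (Fin d) × EuclideanSpace ℝ (Fin n))) volume volume :=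
      (PiLp.volume_preserving_toLp (Fin d)).prod (PiLp.volume_preserving_toLp (Fin n))
    exact (WithLp.volume_preserving_toLp _ _).comp h1
  have hinner : ∀ z ξ : (Fin d → ℝ) × (Fin n → ℝ), inner ℝ (e z) (e ξ)
      = (∑ j, z.1 j * ξ.1 j) + ∑ i, z.2 i * ξ.2 i := by
    intro z ξ
    change inner ℝ
      (WithLp.toLp 2 (WithLp.toLp 2 z.1, WithLp.toLp 2 z.2) :
        WithLp 2 (EuclideanSpace ℝ (Fin d) × EuclideanSpace ℝ (Fin n)))
      (WithLp.toLp 2 (WithLp.toLp 2 ξ.1, WithLp.toLp 2 ξ.2) :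
        WithLp 2 (EuclideanSpace ℝ (Fin d) × EuclideanSpace ℝ (Fin n))) = _
    simp [WithLp.prod_inner_apply, PiLp.inner_apply, mul_comm]
  have hnorm : ∀ ξ : (Fin d → ℝ) × (Fin n → ℝ), ‖ξ‖ ≤ ‖e ξ‖ := by
    intro ξ
    have h0 : ‖e ξ‖ ^ 2 = (∑ j, ξ.1 j * ξ.1 j) + ∑ i, ξ.2 i * ξ.2 i := by
      rw [← hinner, real_inner_self_eq_norm_sq]
    have h1 : 0 ≤ ∑ j, ξ.1 j * ξ.1 j := Finset.sum_nonneg fun j _ => mul_self_nonneg _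
    have h2 : 0 ≤ ∑ j, ξ.2 j * ξ.2 j := Finset.sum_nonneg fun j _ => mul_self_nonneg _
    refine norm_prod_le_iff.2 ⟨?_, ?_⟩
    · refine (pi_norm_le_iff_of_nonneg (norm_nonneg _)).2 fun j => ?_
      rw [Real.norm_eq_abs]
      refine abs_le_of_sq_le_sq ?_ (norm_nonneg _)
      have := Finset.single_le_sum (s := Finset.univ) (f := fun j => ξ.1 j * ξ.1 j)
        (fun _ _ => mul_self_nonneg _) (Finset.mem_univ j)
      nlinarith
    · refine (pi_norm_le_iff_of_nonneg (norm_nonneg _)).2 fun j => ?_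
      rw [Real.norm_eq_abs]
      refine abs_le_of_sq_le_sq ?_ (norm_nonneg _)
      have := Finset.single_le_sum (s := Finset.univ) (f := fun j => ξ.2 j * ξ.2 j)
        (fun _ _ => mul_self_nonneg _) (Finset.mem_univ j)
      nlinarith
  let φ : ContDiffBump (0 : W) := ⟨r / 2, r, by positivity, by linarith⟩
  have hφc : HasCompactSupport (fun w : W => ((φ w : ℝ) : ℂ)) :=
    φ.hasCompactSupport.comp_left (g := fun x : ℝ => (x : ℂ)) (by simp)
  have hφs : ContDiff ℝ (⊤ : ℕ∞) (fun w : W => ((φ w : ℝ) : ℂ)) :=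
    Complex.ofRealCLM.contDiff.comp φ.contDiff
  let g : SchwartzMap W ℂ := hφc.toSchwartzMap hφs
  let G : SchwartzMap W ℂ := FourierTransformInv.fourierInv g
  have hG : FourierTransform.fourier G = g := FourierTransform.fourier_fourierInv_eq g
  let h : SchwartzMap ((Fin d → ℝ) × (Fin n → ℝ)) ℂ :=
    SchwartzMap.compCLMOfContinuousLinearEquiv ℂ e G
  have hF : ∀ ξ, fourierT (⇑h) ξ = g (e ξ) := by
    intro ξ
    rw [← hG, SchwartzMap.fourier_coe, Real.fourier_eq']
    conv_rhs => rw [← he.map_eq]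
    have hme : MeasurableEmbedding (⇑e) := e.toHomeomorph.measurableEmbedding
    rw [hme.integral_map]
    unfold fourierT
    refine integral_congr_ae (Filter.Eventually.of_forall fun z => ?_)
    simp only [smul_eq_mul]
    rw [show inner ℝ (e z) (e ξ) = _ from hinner z ξ]
    have hh : h z = G (e z) := rfl
    rw [hh]
    congr 4
    ring
  refine ⟨h, ?_, ?_⟩
  · intro h0
    have h1 := hF 0
    rw [h0, fourierT_zero, map_zero] at h1
    have h2 : g 0 = ((φ 0 : ℝ) : ℂ) := rfl
    rw [h2, φ.one_of_mem_closedBall (Metric.mem_closedBall_self φ.rIn_pos.le)] at h1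
    simp at h1
  · intro ξ hξ
    rw [hF] at hξ
    have h2 : g (e ξ) = ((φ (e ξ) : ℝ) : ℂ) := rfl
    rw [h2] at hξ
    have h3 : e ξ ∈ Function.support φ := by
      intro h4
      exact hξ (by simp [h4])
    rw [φ.support_eq] at h3
    have h4 : ‖e ξ‖ < r := by
      have := Metric.mem_ball.1 h3
      rwa [dist_zero_right] at this
    exact (hnorm ξ).trans h4.le

lemma Good_ge_one {d n : ℕ} (Q : Fin n → QF d) (Cb : ℝ) (hCb : 1 ≤ Cb) (p : ℝ≥0∞)
    (hp : 1 ≤ p) (hp' : p ≠ ∞) (k : ℕ) (D : ℝ) (hD : D ∈ Good Q Cb p p k) : 1 ≤ D := by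
  classical
  have hp0 : p ≠ 0 := (zero_lt_one.trans_le hp).ne'
  have hpr : 0 < p.toReal := ENNReal.toReal_pos hp0 hp'
  set δ : ℝ := 1 / 2 ^ k with hδ
  have hδ0 : 0 < δ := by positivity
  have hδ1 : δ ≤ 1 := by
    rw [hδ, div_le_one (by positivity)]
    exact one_le_pow₀ (by norm_num)
  obtain ⟨h, hh, hs⟩ := exists_bump (d := d) (n := n) (δ ^ 2) (by positivity)
  have hU : Function.support (fourierT (⇑h)) ⊆ Ubox Q δ Cb 0 := by
    intro ξ hξ
    have h1 := hs ξ hξ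
    have h2 := (norm_fst_le ξ).trans h1
    have h3 := (norm_snd_le ξ).trans h1
    refine ⟨fun j => ξ.1 j / δ, fun i => ξ.2 i / δ ^ 2, ?_, ?_, ?_, ?_⟩
    · intro j
      have h4 : |ξ.1 j| ≤ δ ^ 2 := (norm_le_pi_norm ξ.1 j).trans h2
      rw [abs_div, abs_of_pos hδ0, div_le_iff₀ hδ0]
      nlinarith
    · intro j
      have h4 : |ξ.2 j| ≤ δ ^ 2 := (norm_le_pi_norm ξ.2 j).trans h3
      have hδ2 : 0 < δ ^ 2 := by positivity
      rw [abs_div, abs_of_pos hδ2, div_le_iff₀ hδ2]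
      nlinarith [sq_nonneg δ]
    · ext j
      simp
      field_simp
    · ext i
      simp
      field_simp
  let ν0 : Fin d → Fin (2 ^ k) := fun _ => ⟨0, by positivity⟩
  let h' := Usch Q (center k ν0) 0 h
  have hU' : Function.support (fourierT (⇑h')) ⊆ Ubox Q δ Cb (center k ν0) := by
    have := support_Usch Q (center k ν0) 0 h δ Cb 0 hU
    rwa [zero_add] at this
  have hn : eLpNorm (⇑h') p volume = eLpNorm (⇑h) p volume := by
    rw [← eLpNorm_U Q (center k ν0) 0 p (⇑h) h.continuous.aestronglyMeasurable]
    congr 1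
    ext z
    exact Usch_apply _ _ _ _ _
  have hn0 : eLpNorm (⇑h) p volume ≠ 0 := by
    intro h0
    rw [eLpNorm_eq_zero_iff h.continuous.aestronglyMeasurable hp0] at h0
    have h1 : (⇑h) = fun _ => 0 :=
      (Continuous.ae_eq_iff_eq volume h.continuous continuous_const).1 h0
    apply hh
    ext z
    simp [h1]
  have hnt : eLpNorm (⇑h) p volume ≠ ∞ := (h.memLp p volume).2.ne
  let f : (Fin d → Fin (2 ^ k)) → SchwartzMap ((Fin d → ℝ) × (Fin n → ℝ)) ℂ :=
    fun ν => if ν = ν0 then h' else 0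
  have hf := hD.2 f (by
    intro ν
    by_cases hν : ν = ν0
    · simp only [f, if_pos hν]
      rw [hν]
      exact hU'
    · simp only [f, if_neg hν]
      intro ξ hξ
      exact absurd (fourierT_zero ξ) hξ)
  have h1 : (fun z => ∑ ν, f ν z) = ⇑h' := by
    ext z
    rw [Finset.sum_eq_single ν0]
    · simp [f]
    · intro ν _ hν
      simp [f, hν]
    · simp
  have h2 : lqNorm p (fun ν => eLpNorm (⇑(f ν)) p volume) = eLpNorm (⇑h') p volume := by
    rw [lqNorm, if_neg hp', Finset.sum_eq_single ν0]
    · rw [← ENNReal.rpow_mul, mul_one_div_cancel hpr.ne', ENNReal.rpow_one]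
      simp [f]
    · intro ν _ hν
      simp [f, hν, hpr]
    · simp
  rw [h1, h2, hn] at hf
  by_contra hlt
  push Not at hlt
  have h3 : ENNReal.ofReal D < 1 := by
    rw [← ENNReal.ofReal_one]
    exact (ENNReal.ofReal_lt_ofReal_iff one_pos).2 hlt
  have h4 := ENNReal.mul_lt_mul_left hn0 hnt h3
  rw [one_mul] at h4
  exact absurd hf (not_le.2 h4)

lemma le_lqNorm {ι : Type*} [Fintype ι] (q : ℝ≥0∞) (hq : q ≠ 0) (a : ι → ℝ≥0∞) (i : ι) :
    a i ≤ lqNorm q a := by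
  unfold lqNorm
  split_ifs with h
  · exact le_iSup a i
  · have h0 : 0 < q.toReal := ENNReal.toReal_pos hq h
    have h1 : a i = (a i ^ q.toReal) ^ (1 / q.toReal) := by
      rw [← ENNReal.rpow_mul, mul_one_div_cancel h0.ne', ENNReal.rpow_one]
    rw [h1]
    refine ENNReal.rpow_le_rpow ?_ (by positivity)
    exact Finset.single_le_sum (f := fun i => a i ^ q.toReal) (fun _ _ => zero_le)
      (Finset.mem_univ i)

lemma Good_card {d n : ℕ} (Q : Fin n → QF d) (Cb : ℝ) (q p : ℝ≥0∞) (hq : q ≠ 0)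
    (hp : 1 ≤ p) (k : ℕ) :
    ((Fintype.card (Fin d → Fin (2 ^ k)) : ℕ) : ℝ) ∈ Good Q Cb q p k := by
  refine ⟨by positivity, fun f _ => ?_⟩
  have h1 : (fun z => ∑ ν, f ν z) = ∑ ν, ⇑(f ν) := by
    ext z
    simp
  rw [h1, ENNReal.ofReal_natCast]
  refine (eLpNorm_sum_le (fun ν _ => (f ν).continuous.aestronglyMeasurable) hp).trans ?_
  refine (Finset.sum_le_sum fun ν _ =>
    le_lqNorm q hq (fun ν => eLpNorm (⇑(f ν)) p volume) ν).trans ?_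
  simp

lemma lqNorm_holder {ι : Type*} [Fintype ι] [Nonempty ι] (q p : ℝ≥0∞) (hp : p ≠ 0) (hpq : p < q)
    (a : ι → ℝ≥0∞) :
    lqNorm p a ≤ (Fintype.card ι : ℝ≥0∞) ^ (1 / p.toReal - 1 / q.toReal) * lqNorm q a := by
  have hp' : p ≠ ∞ := hpq.ne_top
  have hpr : 0 < p.toReal := ENNReal.toReal_pos hp hp'
  by_cases hq : q = ∞
  · subst hq
    refine (lqNorm_mono p (b := fun _ => lqNorm ∞ a) fun i => le_lqNorm ∞ (by simp) a i).trans ?_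
    rw [lqNorm_const p hp hp']
    simp
  · have hq0 : q ≠ 0 := (pos_iff_ne_zero.2 hp |>.trans hpq).ne'
    have hqr : 0 < q.toReal := ENNReal.toReal_pos hq0 hq
    have hlt : p.toReal < q.toReal := (ENNReal.toReal_lt_toReal hp' hq).2 hpq
    have h1 := ENNReal.rpow_sum_le_const_mul_sum_rpow (Finset.univ : Finset ι)
      (fun i => a i ^ p.toReal) (p := q.toReal / p.toReal) ((one_le_div hpr).2 hlt.le)
    simp only [← ENNReal.rpow_mul] at h1
    rw [mul_div_cancel₀ _ hpr.ne'] at h1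
    have h2 := ENNReal.rpow_le_rpow h1 (z := 1 / q.toReal) (by positivity)
    rw [← ENNReal.rpow_mul, ENNReal.mul_rpow_of_nonneg _ _ (by positivity),
      ← ENNReal.rpow_mul] at h2
    simp only [lqNorm, if_neg hp', if_neg hq]
    have e1 : q.toReal / p.toReal * (1 / q.toReal) = 1 / p.toReal := by field_simp
    have e2 : (q.toReal / p.toReal - 1) * (1 / q.toReal) = 1 / p.toReal - 1 / q.toReal := by
      field_simp
    rw [e1, e2, Finset.card_univ] at h2
    exact h2

lemma card_rpow (N : ℕ) (hN : 0 < N) (r : ℝ) :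
    (N : ℝ≥0∞) ^ r = ENNReal.ofReal ((N : ℝ) ^ r) := by
  rw [← ENNReal.ofReal_rpow_of_pos (by exact_mod_cast hN), ENNReal.ofReal_natCast]

lemma Good_upper {d n : ℕ} (Q : Fin n → QF d) (Cb : ℝ) (q p : ℝ≥0∞) (hp : p ≠ 0)
    (hpq : p < q) (k : ℕ) (D : ℝ) (hD : D ∈ Good Q Cb p p k) :
    ((Fintype.card (Fin d → Fin (2 ^ k)) : ℕ) : ℝ) ^ (1 / p.toReal - 1 / q.toReal) * D
      ∈ Good Q Cb q p k := by
  have hD0 := hD.1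
  refine ⟨by positivity, fun f hf => (hD.2 f hf).trans ?_⟩
  have h1 := lqNorm_holder q p hp hpq (fun ν => eLpNorm (⇑(f ν)) p volume)
  rw [card_rpow _ Fintype.card_pos] at h1
  rw [mul_comm _ D, ENNReal.ofReal_mul hD0, mul_assoc]
  gcongr

lemma Good_lower {d n : ℕ} (hn : 1 ≤ n) (Q : Fin n → QF d) (Cb : ℝ) (q p : ℝ≥0∞) (hq : q ≠ 0)
    (hp : 1 ≤ p) (hp' : p ≠ ∞) (m : ℕ) (D : ℝ) (hD : D ∈ Good Q Cb q p (m + 1)) :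
    (2 : ℝ) ^ d * ((((2 ^ m) ^ d : ℕ) : ℝ) ^ (1 / p.toReal))⁻¹ *
      ((((2 ^ (m + 1)) ^ d : ℕ) : ℝ) ^ (1 / q.toReal)) * D ∈ Good Q Cb p p (m + 1) := by
  have hD0 := hD.1
  refine ⟨by positivity, fun f hf => ?_⟩
  have h2m : 2 ^ (m + 1) = 2 * 2 ^ m := by ring
  let idx : (Fin d → Fin (2 ^ m)) → (Fin d → Fin (2 ^ m)) → (Fin d → Fin (2 ^ (m + 1))) :=
    fun c a j => ⟨c j + a j, by have := (c j).2; have := (a j).2; omega⟩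
  let sig : (Fin d → Fin 2) → (Fin d → Fin (2 ^ m)) → (Fin d → Fin (2 ^ (m + 1))) :=
    fun σ c j => ⟨(σ j) * 2 ^ m + c j, by
      have := (c j).2
      have h := (σ j).2
      have : (σ j : ℕ) * 2 ^ m ≤ 1 * 2 ^ m := Nat.mul_le_mul_right _ (by omega)
      omega⟩
  have hsig : Function.Bijective (fun x : (Fin d → Fin 2) × (Fin d → Fin (2 ^ m)) =>
      sig x.1 x.2) := by
    rw [Fintype.bijective_iff_injective_and_card]
    constructor
    · rintro ⟨σ, c⟩ ⟨σ', c'⟩ h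
      have h1 : ∀ j, (σ j : ℕ) * 2 ^ m + c j = (σ' j : ℕ) * 2 ^ m + c' j := fun j =>
        congrArg Fin.val (congrFun h j)
      have h2 : ∀ j, σ j = σ' j ∧ c j = c' j := by
        intro j
        have h3 := h1 j
        have h4 := (c j).2
        have h5 := (c' j).2
        have h6 : (σ j : ℕ) = σ' j := by
          have e1 : ((σ j : ℕ) * 2 ^ m + c j) / 2 ^ m = σ j := by
            rw [mul_comm, Nat.mul_add_div (by positivity), Nat.div_eq_of_lt h4, add_zero]
          have e2 : ((σ' j : ℕ) * 2 ^ m + c' j) / 2 ^ m = σ' j := by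
            rw [mul_comm, Nat.mul_add_div (by positivity), Nat.div_eq_of_lt h5, add_zero]
          rw [← e1, ← e2, h3]
        refine ⟨Fin.ext h6, Fin.ext ?_⟩
        rw [h6] at h3
        omega
      exact Prod.ext (funext fun j => (h2 j).1) (funext fun j => (h2 j).2)
    · simp [← mul_pow, h2m]
  set X := lqNorm p (fun ν => eLpNorm (⇑(f ν)) p volume) with hX
  have hσ : ∀ σ, (((2 ^ m) ^ d : ℕ) : ℝ≥0∞) ^ (1 / p.toReal) *
      eLpNorm (fun z => ∑ c, f (sig σ c) z) p volume ≤
      ENNReal.ofReal D * (((2 ^ (m + 1)) ^ d : ℕ) : ℝ≥0∞) ^ (1 / q.toReal) * X := by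
    intro σ
    have h1 := core hn Q Cb q p hq hp hp' (m + 1) D hD idx
      (by
        intro c a a' h
        ext j
        have : (c j : ℕ) + a j = c j + a' j := congrArg Fin.val (congrFun h j)
        omega)
      (by
        intro c c' a h
        ext j
        have : (c j : ℕ) + a j = c' j + a j := congrArg Fin.val (congrFun h j)
        omega)
      (fun a j => ((a j : ℕ) - (σ j : ℕ) * 2 ^ m : ℝ) / 2 ^ (m + 1))
      (fun c => center (m + 1) (sig σ c))
      (by
        intro c a
        ext j
        simp [center, idx, sig]
        ring)
      (fun c => f (sig σ c)) (fun c => hf _)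
    have hc1 : Fintype.card (Fin d → Fin (2 ^ m)) = (2 ^ m) ^ d := by simp
    have hc2 : Fintype.card (Fin d → Fin (2 ^ (m + 1))) = (2 ^ (m + 1)) ^ d := by simp
    rw [hc1, hc2] at h1
    refine h1.trans ?_
    gcongr
    simp only [hX, lqNorm, if_neg hp']
    refine ENNReal.rpow_le_rpow ?_ (by positivity)
    rw [← hsig.sum_comp (fun ν => eLpNorm (⇑(f ν)) p volume ^ p.toReal), Fintype.sum_prod_type]
    exact Finset.single_le_sum
      (f := fun σ => ∑ c, eLpNorm (⇑(f (sig σ c))) p volume ^ p.toReal)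
      (fun _ _ => zero_le) (Finset.mem_univ σ)
  have hsum : (fun z => ∑ ν, f ν z) = ∑ σ, fun z => ∑ c, f (sig σ c) z := by
    ext z
    rw [← hsig.sum_comp (fun ν => f ν z), Fintype.sum_prod_type]
    simp
  have htri : eLpNorm (fun z => ∑ ν, f ν z) p volume ≤
      ∑ σ, eLpNorm (fun z => ∑ c, f (sig σ c) z) p volume := by
    rw [hsum]
    refine eLpNorm_sum_le (fun σ _ => Continuous.aestronglyMeasurable ?_) hp
    exact continuous_finsetSum _ fun c _ => (f (sig σ c)).continuous
  have hA : 0 < (2 ^ m) ^ d := by positivity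
  have hN : 0 < (2 ^ (m + 1)) ^ d := by positivity
  rw [card_rpow _ hA, card_rpow _ hN] at hσ
  set α : ℝ := (((2 ^ m) ^ d : ℕ) : ℝ) ^ (1 / p.toReal) with hα
  set β : ℝ := (((2 ^ (m + 1)) ^ d : ℕ) : ℝ) ^ (1 / q.toReal) with hβ
  have hα0 : 0 < α := Real.rpow_pos_of_pos (by exact_mod_cast hA) _
  have hβ0 : 0 < β := Real.rpow_pos_of_pos (by exact_mod_cast hN) _
  have hσ' : ∀ σ, eLpNorm (fun z => ∑ c, f (sig σ c) z) p volume ≤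
      ENNReal.ofReal (α⁻¹ * β * D) * X := by
    intro σ
    calc eLpNorm (fun z => ∑ c, f (sig σ c) z) p volume
        = ENNReal.ofReal α⁻¹ * (ENNReal.ofReal α *
          eLpNorm (fun z => ∑ c, f (sig σ c) z) p volume) := by
          rw [← mul_assoc, ← ENNReal.ofReal_mul (by positivity), inv_mul_cancel₀ hα0.ne']
          simp
      _ ≤ ENNReal.ofReal α⁻¹ * (ENNReal.ofReal D * ENNReal.ofReal β * X) := by
          exact mul_le_mul' le_rfl (hσ σ)
      _ = _ := by
          rw [ENNReal.ofReal_mul (by positivity), ENNReal.ofReal_mul (by positivity)]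
          ring
  refine htri.trans ((Finset.sum_le_sum fun σ _ => hσ' σ).trans ?_)
  rw [Finset.sum_const, nsmul_eq_mul]
  have : (2 : ℝ) ^ d * α⁻¹ * β * D = 2 ^ d * (α⁻¹ * β * D) := by ring
  rw [this, ENNReal.ofReal_mul (p := (2 : ℝ) ^ d) (by positivity), ENNReal.ofReal_pow (by norm_num), mul_assoc]
  simp [mul_assoc]

lemma DecConst_le_mul {d n : ℕ} (Q : Fin n → QF d) (Cb : ℝ) (q p q' p' : ℝ≥0∞) (k : ℕ)
    (K : ℝ) (hK : 0 < K) (hne : (Good Q Cb q p k).Nonempty)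
    (h : ∀ D ∈ Good Q Cb q p k, K * D ∈ Good Q Cb q' p' k) :
    DecConst Q Cb q' p' k ≤ K * DecConst Q Cb q p k := by
  rw [DecConst_eq, DecConst_eq, ← div_le_iff₀' hK]
  refine le_csInf hne fun D hD => ?_
  rw [div_le_iff₀' hK]
  exact csInf_le ⟨0, fun x hx => hx.1⟩ (h D hD)

/-- The set of admissible growth exponents of a sequence. -/
def ExpSet (c : ℕ → ℝ) : Set ℝ :=
  { G : ℝ | ∀ ε : ℝ, 0 < ε → ∃ Cε : ℝ, ∀ k : ℕ, 1 ≤ k →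
    c k ≤ Cε * (1 / 2 ^ k : ℝ) ^ (-(G + ε)) }

lemma ExpSet_shift (c e : ℕ → ℝ) (K β : ℝ) (hK : 0 ≤ K)
    (h : ∀ k, 1 ≤ k → c k ≤ K * (1 / 2 ^ k : ℝ) ^ (-β) * e k) (G : ℝ) (hG : G ∈ ExpSet e) :
    G + β ∈ ExpSet c := by
  intro ε hε
  obtain ⟨C, hC⟩ := hG ε hε
  refine ⟨K * C, fun k hk => (h k hk).trans ?_⟩
  have hx : (0 : ℝ) < 1 / 2 ^ k := by positivity
  have e1 : -(G + β + ε) = -β + -(G + ε) := by ring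
  rw [e1, Real.rpow_add hx]
  calc K * (1 / 2 ^ k : ℝ) ^ (-β) * e k
      ≤ K * (1 / 2 ^ k : ℝ) ^ (-β) * (C * (1 / 2 ^ k : ℝ) ^ (-(G + ε))) :=
        mul_le_mul_of_nonneg_left (hC k hk) (by positivity)
    _ = _ := by ring

lemma sInf_shift (A B : Set ℝ) (β : ℝ) (hB : B.Nonempty) (hb : BddBelow B)
    (h1 : ∀ G ∈ B, G + β ∈ A) (h2 : ∀ G ∈ A, G + -β ∈ B) : sInf A = sInf B + β := by
  obtain ⟨G0, hG0⟩ := hB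
  obtain ⟨l, hl⟩ := hb
  have hA : A.Nonempty := ⟨_, h1 _ hG0⟩
  have hbA : BddBelow A := ⟨l + β, fun G hG => by have := hl (h2 G hG); linarith⟩
  apply le_antisymm
  · have : sInf A - β ≤ sInf B := le_csInf ⟨G0, hG0⟩ fun G hG => by
      have := csInf_le hbA (h1 G hG)
      linarith
    linarith
  · refine le_csInf hA fun G hG => ?_
    have := csInf_le ⟨l, hl⟩ (h2 G hG)
    linarith

lemma ExpSet_bdd (e : ℕ → ℝ) (h : ∀ k, 1 ≤ e k) : BddBelow (ExpSet e) := by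
  refine ⟨-1, fun G hG => ?_⟩
  by_contra hlt
  push Not at hlt
  obtain ⟨C, hC⟩ := hG 1 one_pos
  set s : ℝ := -(G + 1) with hs
  have hs0 : 0 < s := by rw [hs]; linarith
  have ht : Filter.Tendsto (fun k : ℕ => C * (1 / 2 ^ k : ℝ) ^ s) Filter.atTop (nhds 0) := by
    have h1 : Filter.Tendsto (fun k : ℕ => (1 / 2 ^ k : ℝ)) Filter.atTop (nhds 0) := by
      have := tendsto_pow_atTop_nhds_zero_of_lt_one (r := (1 / 2 : ℝ)) (by norm_num) (by norm_num)
      simpa [one_div] using this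
    have h2 := (h1.rpow_const (p := s) (Or.inr hs0.le)).const_mul C
    simpa [Real.zero_rpow hs0.ne'] using h2
  have h3 : (1 : ℝ) ≤ 0 := by
    refine ge_of_tendsto ht ?_
    filter_upwards [Filter.eventually_ge_atTop 1] with k hk
    exact (h k).trans (hC k hk)
  linarith

lemma pow_aux (k d : ℕ) (r : ℝ) :
    ((((2 ^ k) ^ d : ℕ) : ℝ)) ^ r = (2 : ℝ) ^ ((k : ℝ) * d * r) := by
  push_cast
  rw [← pow_mul, ← Real.rpow_natCast, ← Real.rpow_mul (by norm_num)]
  push_cast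
  rfl

lemma inv_aux (k : ℕ) (r : ℝ) : (1 / 2 ^ k : ℝ) ^ (-r) = (2 : ℝ) ^ ((k : ℝ) * r) := by
  rw [one_div, ← Real.rpow_natCast, ← Real.rpow_neg (by norm_num), ← Real.rpow_mul (by norm_num)]
  congr 1
  ring

/-- Theorem 8.1, sharp `ℓ^q L^p` decoupling with `q > p`: for
`2 ≤ p < q ≤ ∞` (with `1/∞ = 0`), `Γ_{q,p}(𝐪) = Γ_{p,p}(𝐪) + d(1/p - 1/q)`. -/
theorem statement_19 (d n : ℕ) (hd : 1 ≤ d) (hn : 1 ≤ n)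
    (Q : Fin n → QF d) (Cb : ℝ) (hCb : 1 ≤ Cb)
    (q p : ℝ≥0∞) (hp : 2 ≤ p) (hpq : p < q) :
    Gamma Q Cb q p = Gamma Q Cb p p + (d : ℝ) * (1 / p.toReal - 1 / q.toReal) := by
  have hp1 : 1 ≤ p := one_le_two.trans hp
  have hp0 : p ≠ 0 := (zero_lt_one.trans_le hp1).ne'
  have hp' : p ≠ ∞ := hpq.ne_top
  have hq0 : q ≠ 0 := ((zero_lt_one.trans_le hp1).trans hpq).ne'
  have hcard : ∀ k, Fintype.card (Fin d → Fin (2 ^ k)) = (2 ^ k) ^ d := fun k => by simp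
  set β : ℝ := (d : ℝ) * (1 / p.toReal - 1 / q.toReal) with hβ
  have hup : ∀ k, DecConst Q Cb q p k ≤ 1 * (1 / 2 ^ k : ℝ) ^ (-β) * DecConst Q Cb p p k := by
    intro k
    have h1 := DecConst_le_mul Q Cb p p q p k
      (((Fintype.card (Fin d → Fin (2 ^ k)) : ℕ) : ℝ) ^ (1 / p.toReal - 1 / q.toReal))
      (Real.rpow_pos_of_pos (by exact_mod_cast Fintype.card_pos) _)
      ⟨_, Good_card Q Cb p p hp0 hp1 k⟩ (Good_upper Q Cb q p hp0 hpq k)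
    rw [hcard, pow_aux] at h1
    rw [one_mul, inv_aux, hβ, ← mul_assoc]
    exact h1
  have hlow : ∀ k, 1 ≤ k → DecConst Q Cb p p k ≤
      ((2 : ℝ) ^ d * (2 : ℝ) ^ ((d : ℝ) * (1 / p.toReal))) * (1 / 2 ^ k : ℝ) ^ (-(-β)) *
        DecConst Q Cb q p k := by
    intro k hk
    obtain ⟨m, rfl⟩ : ∃ m, k = m + 1 := ⟨k - 1, by omega⟩
    have h1 := DecConst_le_mul Q Cb q p p p (m + 1)
      ((2 : ℝ) ^ d * ((((2 ^ m) ^ d : ℕ) : ℝ) ^ (1 / p.toReal))⁻¹ *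
        ((((2 ^ (m + 1)) ^ d : ℕ) : ℝ) ^ (1 / q.toReal)))
      (by rw [pow_aux, pow_aux]; positivity)
      ⟨_, Good_card Q Cb q p hq0 hp1 (m + 1)⟩ (Good_lower hn Q Cb q p hq0 hp1 hp' m)
    refine h1.trans (le_of_eq ?_)
    congr 1
    rw [pow_aux, pow_aux, inv_aux, ← Real.rpow_neg (by norm_num), mul_assoc,
      ← Real.rpow_add (by norm_num), mul_assoc ((2 : ℝ) ^ d), ← Real.rpow_add (by norm_num)]
    congr 2
    rw [hβ]
    push_cast
    ring
  refine sInf_shift (ExpSet (DecConst Q Cb q p)) (ExpSet (DecConst Q Cb p p)) β ?_ ?_ ?_ ?_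
  · refine ⟨d, fun ε hε => ⟨1, fun k hk => ?_⟩⟩
    have h1 : DecConst Q Cb p p k ≤ ((Fintype.card (Fin d → Fin (2 ^ k)) : ℕ) : ℝ) := by
      rw [DecConst_eq]
      exact csInf_le ⟨0, fun x hx => hx.1⟩ (Good_card Q Cb p p hp0 hp1 k)
    have h2 := pow_aux k d 1
    rw [Real.rpow_one] at h2
    rw [hcard, h2] at h1
    rw [one_mul, inv_aux]
    refine h1.trans (Real.rpow_le_rpow_of_exponent_le (by norm_num) ?_)
    have : (0 : ℝ) ≤ (k : ℝ) * ε := by positivity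
    linarith
  · refine ExpSet_bdd _ fun k => ?_
    rw [DecConst_eq]
    exact le_csInf ⟨_, Good_card Q Cb p p hp0 hp1 k⟩ (Good_ge_one Q Cb hCb p hp1 hp' k)
  · exact ExpSet_shift _ _ 1 β zero_le_one fun k _ => hup k
  · exact ExpSet_shift _ _ _ (-β) (by positivity) hlow

end GOZZK
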